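/- Let u : ℝ³ → ℝ be a smooth solution of the 3D Pavlov equation u_yy = u_tx + u_y u_xx − u_x u_xy. Let ψ : ℝ³ → ℝ be a smooth solution of the linearized Pavlov equation ℓ_E(ψ) = 0, and suppose φ : ℝ³ → ℝ is a smooth function satisfying the first-order system ∂_x φ = u_x ∂_x ψ + ∂_y ψ − u_xx ψ and ∂_y φ = ∂_t ψ + u_y ∂_x ψ − u_xy ψ. Then φ also satisfies ℓ_E(φ) = 0. (The system defines the recursion operator R₋, inverse to R₊, for shadows of symmetries of the Pavlov equation.) -/

import Mathlib

noncomputable section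

/-- Partial derivative with respect to the first variable (`x`). -/
def Dx (f : ℝ → ℝ → ℝ → ℝ) (x y t : ℝ) : ℝ := deriv (fun x' => f x' y t) x

/-- Partial derivative with respect to the second variable (`y`). -/
def Dy (f : ℝ → ℝ → ℝ → ℝ) (x y t : ℝ) : ℝ := deriv (fun y' => f x y' t) y

/-- Partial derivative with respect to the third variable (`t`). -/
def Dt (f : ℝ → ℝ → ℝ → ℝ) (x y t : ℝ) : ℝ := deriv (fun t' => f x y t') t

/-- Smoothness of a function of three real variables `(x, y, t)`. -/
def Smooth3 (f : ℝ → ℝ → ℝ → ℝ) : Prop :=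
  ContDiff ℝ (⊤ : ℕ∞) (fun p : ℝ × ℝ × ℝ => f p.1 p.2.1 p.2.2)

/-- Linearization of the Pavlov equation `u_yy = u_tx + u_y u_xx - u_x u_xy` at a solution `u`. -/
def linPavlov (u φ : ℝ → ℝ → ℝ → ℝ) (x y t : ℝ) : ℝ :=
  Dy (Dy φ) x y t - Dt (Dx φ) x y t - Dy u x y t * Dx (Dx φ) x y t
    + Dx u x y t * Dx (Dy φ) x y t - Dx (Dx u) x y t * Dy φ x y t
    + Dx (Dy u) x y t * Dx φ x y t

open scoped ContDiff

/-- A function of three real variables, viewed as a function on `ℝ × ℝ × ℝ`. -/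
def uncurryThree (f : ℝ → ℝ → ℝ → ℝ) (p : ℝ × ℝ × ℝ) : ℝ := f p.1 p.2.1 p.2.2

namespace Smooth3

variable {f : ℝ → ℝ → ℝ → ℝ}

theorem contDiff (hf : Smooth3 f) : ContDiff ℝ ∞ (uncurryThree f) := hf

theorem hasFDerivAt (hf : Smooth3 f) (p : ℝ × ℝ × ℝ) :
    HasFDerivAt (uncurryThree f) (fderiv ℝ (uncurryThree f) p) p :=
  (hf.contDiff.differentiable (by simp) p).hasFDerivAt

theorem hasDerivAt_x_fderiv (hf : Smooth3 f) (x y t : ℝ) :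
    HasDerivAt (fun x' => f x' y t) (fderiv ℝ (uncurryThree f) (x, y, t) (1, 0, 0)) x := by
  have h : HasDerivAt (fun x' : ℝ => (x', y, t)) ((1, 0, 0) : ℝ × ℝ × ℝ) x :=
    (hasDerivAt_id x).prodMk ((hasDerivAt_const x y).prodMk (hasDerivAt_const x t))
  exact (hf.hasFDerivAt (x, y, t)).comp_hasDerivAt x h

theorem hasDerivAt_y_fderiv (hf : Smooth3 f) (x y t : ℝ) :
    HasDerivAt (fun y' => f x y' t) (fderiv ℝ (uncurryThree f) (x, y, t) (0, 1, 0)) y := by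
  have h : HasDerivAt (fun y' : ℝ => (x, y', t)) ((0, 1, 0) : ℝ × ℝ × ℝ) y :=
    (hasDerivAt_const y x).prodMk ((hasDerivAt_id y).prodMk (hasDerivAt_const y t))
  exact (hf.hasFDerivAt (x, y, t)).comp_hasDerivAt y h

theorem hasDerivAt_t_fderiv (hf : Smooth3 f) (x y t : ℝ) :
    HasDerivAt (fun t' => f x y t') (fderiv ℝ (uncurryThree f) (x, y, t) (0, 0, 1)) t := by
  have h : HasDerivAt (fun t' : ℝ => (x, y, t')) ((0, 0, 1) : ℝ × ℝ × ℝ) t :=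
    (hasDerivAt_const t x).prodMk ((hasDerivAt_const t y).prodMk (hasDerivAt_id t))
  exact (hf.hasFDerivAt (x, y, t)).comp_hasDerivAt t h

theorem uncurryThree_dx (hf : Smooth3 f) :
    uncurryThree (Dx f) = fun p => fderiv ℝ (uncurryThree f) p (1, 0, 0) :=
  funext fun p => (hf.hasDerivAt_x_fderiv p.1 p.2.1 p.2.2).deriv

theorem uncurryThree_dy (hf : Smooth3 f) :
    uncurryThree (Dy f) = fun p => fderiv ℝ (uncurryThree f) p (0, 1, 0) :=
  funext fun p => (hf.hasDerivAt_y_fderiv p.1 p.2.1 p.2.2).deriv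

theorem uncurryThree_dt (hf : Smooth3 f) :
    uncurryThree (Dt f) = fun p => fderiv ℝ (uncurryThree f) p (0, 0, 1) :=
  funext fun p => (hf.hasDerivAt_t_fderiv p.1 p.2.1 p.2.2).deriv

theorem contDiff_fderiv (hf : Smooth3 f) : ContDiff ℝ ∞ (fderiv ℝ (uncurryThree f)) :=
  hf.contDiff.fderiv_right (by simp)

theorem dx (hf : Smooth3 f) : Smooth3 (Dx f) := by
  change ContDiff ℝ ∞ (uncurryThree (Dx f))
  rw [hf.uncurryThree_dx]
  exact hf.contDiff_fderiv.clm_apply contDiff_const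

theorem dy (hf : Smooth3 f) : Smooth3 (Dy f) := by
  change ContDiff ℝ ∞ (uncurryThree (Dy f))
  rw [hf.uncurryThree_dy]
  exact hf.contDiff_fderiv.clm_apply contDiff_const

theorem dt (hf : Smooth3 f) : Smooth3 (Dt f) := by
  change ContDiff ℝ ∞ (uncurryThree (Dt f))
  rw [hf.uncurryThree_dt]
  exact hf.contDiff_fderiv.clm_apply contDiff_const

theorem hasDerivAt_x (hf : Smooth3 f) (x y t : ℝ) :
    HasDerivAt (fun x' => f x' y t) (Dx f x y t) x :=
  (hf.hasDerivAt_x_fderiv x y t).differentiableAt.hasDerivAt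

theorem hasDerivAt_y (hf : Smooth3 f) (x y t : ℝ) :
    HasDerivAt (fun y' => f x y' t) (Dy f x y t) y :=
  (hf.hasDerivAt_y_fderiv x y t).differentiableAt.hasDerivAt

theorem hasDerivAt_t (hf : Smooth3 f) (x y t : ℝ) :
    HasDerivAt (fun t' => f x y t') (Dt f x y t) t :=
  (hf.hasDerivAt_t_fderiv x y t).differentiableAt.hasDerivAt

theorem fderiv_fderiv_apply (hf : Smooth3 f) (p v w : ℝ × ℝ × ℝ) :
    fderiv ℝ (fun q => fderiv ℝ (uncurryThree f) q v) p w =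
      fderiv ℝ (fderiv ℝ (uncurryThree f)) p w v := by
  rw [fderiv_clm_apply (hf.contDiff_fderiv.differentiable (by simp) p)
    (differentiableAt_const v)]
  simp

theorem fderiv_fderiv_comm (hf : Smooth3 f) (p v w : ℝ × ℝ × ℝ) :
    fderiv ℝ (fun q => fderiv ℝ (uncurryThree f) q v) p w =
      fderiv ℝ (fun q => fderiv ℝ (uncurryThree f) q w) p v := by
  rw [hf.fderiv_fderiv_apply, hf.fderiv_fderiv_apply]
  exact (hf.contDiff.contDiffAt.isSymmSndFDerivAt (by
    simpa using WithTop.coe_le_coe.2 (le_top : (2 : ℕ∞) ≤ ⊤))).eq w v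

theorem dy_dx (hf : Smooth3 f) (x y t : ℝ) : Dy (Dx f) x y t = Dx (Dy f) x y t := by
  rw [Dy, Dx, (hf.dx.hasDerivAt_y_fderiv x y t).deriv,
    (hf.dy.hasDerivAt_x_fderiv x y t).deriv, hf.uncurryThree_dx, hf.uncurryThree_dy,
    hf.fderiv_fderiv_comm]

theorem dt_dx (hf : Smooth3 f) (x y t : ℝ) : Dt (Dx f) x y t = Dx (Dt f) x y t := by
  rw [Dt, Dx, (hf.dx.hasDerivAt_t_fderiv x y t).deriv,
    (hf.dt.hasDerivAt_x_fderiv x y t).deriv, hf.uncurryThree_dx, hf.uncurryThree_dt,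
    hf.fderiv_fderiv_comm]

theorem dt_dy (hf : Smooth3 f) (x y t : ℝ) : Dt (Dy f) x y t = Dy (Dt f) x y t := by
  rw [Dt, Dy, (hf.dy.hasDerivAt_t_fderiv x y t).deriv,
    (hf.dt.hasDerivAt_y_fderiv x y t).deriv, hf.uncurryThree_dy, hf.uncurryThree_dt,
    hf.fderiv_fderiv_comm]

end Smooth3

/-- The inverse recursion operator `R₋` of the Pavlov equation maps shadows to shadows. -/
theorem pavlov_recursion_minus
    (u : ℝ → ℝ → ℝ → ℝ) (hu : Smooth3 u)
    (husol : ∀ x y t : ℝ, Dy (Dy u) x y t = Dt (Dx u) x y t + Dy u x y t * Dx (Dx u) x y t - Dx u x y t * Dx (Dy u) x y t)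
    (ψ : ℝ → ℝ → ℝ → ℝ) (hψ : Smooth3 ψ)
    (hψsh : ∀ x y t : ℝ, linPavlov u ψ x y t = 0)
    (φ : ℝ → ℝ → ℝ → ℝ) (hφ : Smooth3 φ)
    (hsys_x : ∀ x y t : ℝ,
      Dx φ x y t = Dx u x y t * Dx ψ x y t + Dy ψ x y t - Dx (Dx u) x y t * ψ x y t)
    (hsys_y : ∀ x y t : ℝ,
      Dy φ x y t = Dt ψ x y t + Dy u x y t * Dx ψ x y t - Dx (Dy u) x y t * ψ x y t) :
    ∀ x y t : ℝ, linPavlov u φ x y t = 0 := by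
  intro x y t
  have hx := funext fun x => funext fun y => funext fun t => hsys_x x y t
  have hy := funext fun x => funext fun y => funext fun t => hsys_y x y t
  have hxx : Dx (Dx φ) x y t =
      Dx (Dx u) x y t * Dx ψ x y t + Dx u x y t * Dx (Dx ψ) x y t + Dx (Dy ψ) x y t -
        (Dx (Dx (Dx u)) x y t * ψ x y t + Dx (Dx u) x y t * Dx ψ x y t) := by
    rw [hx]
    exact ((((hu.dx.hasDerivAt_x x y t).mul (hψ.dx.hasDerivAt_x x y t)).add
      (hψ.dy.hasDerivAt_x x y t)).sub ((hu.dx.dx.hasDerivAt_x x y t).mul (hψ.hasDerivAt_x x y t))).deriv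
  have htx : Dt (Dx φ) x y t =
      Dt (Dx u) x y t * Dx ψ x y t + Dx u x y t * Dt (Dx ψ) x y t + Dt (Dy ψ) x y t -
        (Dt (Dx (Dx u)) x y t * ψ x y t + Dx (Dx u) x y t * Dt ψ x y t) := by
    rw [hx]
    exact ((((hu.dx.hasDerivAt_t x y t).mul (hψ.dx.hasDerivAt_t x y t)).add
      (hψ.dy.hasDerivAt_t x y t)).sub ((hu.dx.dx.hasDerivAt_t x y t).mul (hψ.hasDerivAt_t x y t))).deriv
  have hxy : Dx (Dy φ) x y t =
      Dx (Dt ψ) x y t + (Dx (Dy u) x y t * Dx ψ x y t + Dy u x y t * Dx (Dx ψ) x y t) -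
        (Dx (Dx (Dy u)) x y t * ψ x y t + Dx (Dy u) x y t * Dx ψ x y t) := by
    rw [hy]
    exact (((hψ.dt.hasDerivAt_x x y t).add ((hu.dy.hasDerivAt_x x y t).mul
      (hψ.dx.hasDerivAt_x x y t))).sub ((hu.dy.dx.hasDerivAt_x x y t).mul (hψ.hasDerivAt_x x y t))).deriv
  have hyy : Dy (Dy φ) x y t =
      Dy (Dt ψ) x y t + (Dy (Dy u) x y t * Dx ψ x y t + Dy u x y t * Dy (Dx ψ) x y t) -
        (Dy (Dx (Dy u)) x y t * ψ x y t + Dx (Dy u) x y t * Dy ψ x y t) := by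
    rw [hy]
    exact (((hψ.dt.hasDerivAt_y x y t).add ((hu.dy.hasDerivAt_y x y t).mul
      (hψ.dx.hasDerivAt_y x y t))).sub ((hu.dy.dx.hasDerivAt_y x y t).mul (hψ.hasDerivAt_y x y t))).deriv
  have husol_x : Dx (Dy (Dy u)) x y t =
      Dx (Dt (Dx u)) x y t +
        (Dx (Dy u) x y t * Dx (Dx u) x y t + Dy u x y t * Dx (Dx (Dx u)) x y t) -
        (Dx (Dx u) x y t * Dx (Dy u) x y t + Dx u x y t * Dx (Dx (Dy u)) x y t) := by
    rw [funext fun x => funext fun y => funext fun t => husol x y t]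
    exact (((hu.dx.dt.hasDerivAt_x x y t).add ((hu.dy.hasDerivAt_x x y t).mul
      (hu.dx.dx.hasDerivAt_x x y t))).sub ((hu.dx.hasDerivAt_x x y t).mul
      (hu.dy.dx.hasDerivAt_x x y t))).deriv
  rw [linPavlov, hxx, htx, hxy, hyy, hsys_x, hsys_y, hψ.dy_dx, hψ.dt_dx, hψ.dt_dy,
    hu.dy.dy_dx, husol_x, husol, hu.dx.dt_dx]
  ring
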